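/- Let p and q be acyclic MLL proof nets with p ⇒e q (parallel elimination of a family of evanescent cuts). Then: (1) for every subtree t of p, the cardinality of ⋃_{n∈ℕ} Iⁿ(t) is at most (2·jd(p))^{ln(p)+1}; and (2) the number of evanescent cuts in p is at most size(q)·(2·jd(p))^{ln(p)+1}. -/

import Mathlib

/- Formalization of untyped MLL proof nets with jumps, switching paths,
   and parallel cut elimination, following Chouquet & Vaux Auclair. -/

namespace MLLNets

attribute [local instance] Classical.propDecidable

/-- Trees of MLL nets: variables (axiom conclusions, paired by the involution
    `(n,b) ↦ (n,!b)`), labelled units `1_λ`, labelled counits `⊥_μ`, and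
    n-ary connectives `⊗`, `⅋`. -/
inductive Tree : Type where
  | var : ℕ → Bool → Tree
  | unit : ℕ → Tree
  | counit : ℕ → Tree
  | tens : List Tree → Tree
  | parr : List Tree → Tree

instance : Inhabited Tree := ⟨Tree.unit 0⟩

/-- Atoms: variables, unit labels, counit labels. -/
inductive Atom : Type where
  | var : ℕ → Bool → Atom
  | unit : ℕ → Atom
  | counit : ℕ → Atom

namespace Tree

/-- Number of subtrees of a tree. -/
def size : Tree → ℕ
  | var _ _ => 1
  | unit _ => 1
  | counit _ => 1
  | tens ts => 1 + (ts.attach.map (fun x => x.1.size)).sum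
  | parr ts => 1 + (ts.attach.map (fun x => x.1.size)).sum
termination_by t => sizeOf t
decreasing_by all_goals (have h := List.sizeOf_lt_of_mem x.2; simp; omega)

/-- The set of subtrees of a tree. -/
noncomputable def ST : Tree → Finset Tree
  | var n b => {var n b}
  | unit l => {unit l}
  | counit l => {counit l}
  | tens ts => insert (tens ts) ((ts.attach.map (fun x => x.1.ST)).foldr (· ∪ ·) ∅)
  | parr ts => insert (parr ts) ((ts.attach.map (fun x => x.1.ST)).foldr (· ∪ ·) ∅)
termination_by t => sizeOf t
decreasing_by all_goals (have h := List.sizeOf_lt_of_mem x.2; simp; omega)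

/-- The multiset of atoms occurring in a tree. -/
def atoms : Tree → Multiset Atom
  | var n b => {Atom.var n b}
  | unit l => {Atom.unit l}
  | counit l => {Atom.counit l}
  | tens ts => (ts.attach.map (fun x => x.1.atoms)).sum
  | parr ts => (ts.attach.map (fun x => x.1.atoms)).sum
termination_by t => sizeOf t
decreasing_by all_goals (have h := List.sizeOf_lt_of_mem x.2; simp; omega)

/-- Substitution of the tree `s` for the variable `(n, b)`. -/
def subst (n : ℕ) (b : Bool) (s : Tree) : Tree → Tree
  | var m c => if m = n ∧ c = b then s else var m c
  | unit l => unit l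
  | counit l => counit l
  | tens ts => tens (ts.attach.map (fun x => Tree.subst n b s x.1))
  | parr ts => parr (ts.attach.map (fun x => Tree.subst n b s x.1))
termination_by t => sizeOf t
decreasing_by all_goals (have h := List.sizeOf_lt_of_mem x.2; simp; omega)

/-- Iterated substitution `t[t₁/x̄₁]⋯[tₙ/x̄ₙ]`: each list entry `((n,b), s)`
    records an axiom cut `⟨x|s⟩` with `x = (n,b)`, and `s` is substituted
    for `x̄ = (n, !b)`. -/
def substList (l : List ((ℕ × Bool) × Tree)) (t : Tree) : Tree :=
  l.foldl (fun u e => u.subst e.1.1 (!e.1.2) e.2) t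

end Tree

/-- A (bare) proof net with a jump function: a finite set of cuts, a finite
    family of conclusion trees, and a jump function assigning a tree to each
    counit label. -/
structure Net : Type where
  cuts : Finset (Tree × Tree)
  concl : List Tree
  jump : ℕ → Tree

namespace Net

/-- The subtrees of a net. -/
noncomputable def ST (p : Net) : Finset Tree :=
  (p.cuts.biUnion fun c => c.1.ST ∪ c.2.ST) ∪ (p.concl.map Tree.ST).foldr (· ∪ ·) ∅

/-- The multiset of atoms of a net. -/
def atoms (p : Net) : Multiset Atom :=
  (p.cuts.val.map fun c => c.1.atoms + c.2.atoms).sum + (p.concl.map Tree.atoms).sum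

/-- The counit labels occurring in a net. -/
noncomputable def counitLabels (p : Net) : Finset ℕ :=
  p.ST.biUnion fun t => match t with | Tree.counit l => {l} | _ => ∅

/-- The size of a net: its number of subtrees. -/
def size (p : Net) : ℕ :=
  (p.cuts.sum fun c => c.1.size + c.2.size) + (p.concl.map Tree.size).sum

/-- Well-formedness: each atom occurs at most once, connectives have arity
    ≥ 1, variables are closed under the involution, and jumps of counits
    occurring in the net are subtrees of the net. -/
def IsMLL (p : Net) : Prop :=
  p.atoms.Nodup ∧
  (∀ ts, Tree.tens ts ∈ p.ST → ts ≠ []) ∧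
  (∀ ts, Tree.parr ts ∈ p.ST → ts ≠ []) ∧
  (∀ n b, Atom.var n b ∈ p.atoms → Atom.var n (!b) ∈ p.atoms) ∧
  (∀ m, Tree.counit m ∈ p.ST → p.jump m ∈ p.ST)

end Net

/-- Edges of switching graphs: axiom edges, ⊗-edges (one per premise),
    ⅋-edges (one per ⅋-tree, its other endpoint chosen by the switching),
    jump edges and cut edges. -/
inductive Edge : Type where
  | ax : ℕ → Edge
  | tensE : Tree → Tree → Edge
  | parrE : Tree → Edge
  | jumpE : ℕ → Edge
  | cutE : Tree → Tree → Edge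

/-- A switching chooses a premise of each ⅋-subtree. -/
def Net.IsSwitching (p : Net) (I : Tree → Tree) : Prop :=
  ∀ ts, Tree.parr ts ∈ p.ST → I (Tree.parr ts) ∈ ts

/-- Adjacency in the switching graph of `p` determined by the switching `I`. -/
inductive Net.Adj (p : Net) (I : Tree → Tree) : Edge → Tree → Tree → Prop
  | ax (n : ℕ) : Tree.var n true ∈ p.ST → Tree.var n false ∈ p.ST →
      Net.Adj p I (Edge.ax n) (Tree.var n true) (Tree.var n false)
  | tens {ts t} : Tree.tens ts ∈ p.ST → t ∈ ts →
      Net.Adj p I (Edge.tensE (Tree.tens ts) t) (Tree.tens ts) t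
  | parr {ts} : Tree.parr ts ∈ p.ST →
      Net.Adj p I (Edge.parrE (Tree.parr ts)) (Tree.parr ts) (I (Tree.parr ts))
  | jump {m} : Tree.counit m ∈ p.ST →
      Net.Adj p I (Edge.jumpE m) (Tree.counit m) (p.jump m)
  | cut {t s} : (t, s) ∈ p.cuts → Net.Adj p I (Edge.cutE t s) t s
  | symm {e t u} : Net.Adj p I e t u → Net.Adj p I e u t

/-- `IsTrail p I t l` : `l` is a switching path (a sequence of pairwise
    distinct consecutive edges, each paired with the vertex it reaches)
    starting from the subtree `t`. -/
inductive Net.IsTrail (p : Net) (I : Tree → Tree) : Tree → List (Edge × Tree) → Prop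
  | nil (t) : t ∈ p.ST → Net.IsTrail p I t []
  | cons {t e u l} : Net.Adj p I e t u → Net.IsTrail p I u l → (∀ x ∈ l, x.1 ≠ e) →
      Net.IsTrail p I t ((e, u) :: l)

/-- `ln p` : the maximal length of a switching path of `p`. -/
noncomputable def Net.ln (p : Net) : ℕ :=
  sSup {n | ∃ I t l, p.IsSwitching I ∧ p.IsTrail I t l ∧ l.length = n}

/-- `jd p` : the maximal number of counit labels jumping to a common
    subtree of `p`. -/
noncomputable def Net.jd (p : Net) : ℕ :=
  p.ST.sup fun t => (p.counitLabels.filter fun m => p.jump m = t).card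

/-- A net is acyclic when no switching path visits the same subtree twice. -/
def Net.IsAcyclic (p : Net) : Prop :=
  ∀ I, p.IsSwitching I → ∀ t l, p.IsTrail I t l → (t :: l.map Prod.snd).Nodup

/-! ### Parallel cut elimination -/

/-- Cuts of `p` eliminated by the multiplicative family `F` (given by the
    lists of premises of the ⊗- and ⅋-trees of each cut). -/
noncomputable def melim (F : Finset (List Tree × List Tree)) : Finset (Tree × Tree) :=
  F.biUnion fun c => {(Tree.tens c.1, Tree.parr c.2), (Tree.parr c.2, Tree.tens c.1)}

/-- Residual cuts produced by the multiplicative family `F`. -/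
noncomputable def mres (F : Finset (List Tree × List Tree)) : Finset (Tree × Tree) :=
  F.biUnion fun c => (c.1.zip c.2).toFinset

/-- Cuts of `p` eliminated by an axiom family. -/
noncomputable def aelim (la : List ((ℕ × Bool) × Tree)) : Finset (Tree × Tree) :=
  la.foldr (fun e s =>
    insert (Tree.var e.1.1 e.1.2, e.2) (insert (e.2, Tree.var e.1.1 e.1.2) s)) ∅

/-- Cuts of `p` eliminated by an evanescent family (pairs `(λ, μ)` of a unit
    and a counit label). -/
noncomputable def eelim (le : List (ℕ × ℕ)) : Finset (Tree × Tree) :=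
  le.foldr (fun e s =>
    insert (Tree.unit e.1, Tree.counit e.2) (insert (Tree.counit e.2, Tree.unit e.1) s)) ∅

/-- The redirection function `ρ` for the parallel elimination of evanescent
    cuts: `Rho p le j t` holds when the jump of the `j`-th eliminated
    counit, followed along the chain of eliminated evanescent cuts, ends
    at the tree `t`. -/
inductive Rho (p : Net) (le : List (ℕ × ℕ)) : ℕ → Tree → Prop
  | base (j : ℕ) :
      (∀ i < j, p.jump ((le.getD j (0,0)).2) ≠ Tree.counit ((le.getD i (0,0)).2) ∧
                p.jump ((le.getD j (0,0)).2) ≠ Tree.unit ((le.getD i (0,0)).1)) →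
      Rho p le j (p.jump ((le.getD j (0,0)).2))
  | step {i j : ℕ} {t : Tree} : i < j →
      (p.jump ((le.getD j (0,0)).2) = Tree.counit ((le.getD i (0,0)).2) ∨
       p.jump ((le.getD j (0,0)).2) = Tree.unit ((le.getD i (0,0)).1)) →
      Rho p le i t → Rho p le j t

/-- `ParStepF p q F la le` : `q` is obtained from `p` by the simultaneous
    elimination of the family `F` of multiplicative cuts, the family `la` of
    axiom cuts and the family `le` of evanescent cuts. -/
structure ParStepF (p q : Net) (F : Finset (List Tree × List Tree))
    (la : List ((ℕ × Bool) × Tree)) (le : List (ℕ × ℕ)) : Prop where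
  /-- each member of `F` is a multiplicative cut of `p` -/
  hF : ∀ c ∈ F, c.1.length = c.2.length ∧ c.1 ≠ [] ∧
       ((Tree.tens c.1, Tree.parr c.2) ∈ p.cuts ∨ (Tree.parr c.2, Tree.tens c.1) ∈ p.cuts)
  /-- each member of `la` is an axiom cut of `p` -/
  ha : ∀ e ∈ la, (Tree.var e.1.1 e.1.2, e.2) ∈ p.cuts ∨ (e.2, Tree.var e.1.1 e.1.2) ∈ p.cuts
  haN : (la.map Prod.fst).Nodup
  /-- `x̄ᵢ ∉ {x₁, …, xₙ}` -/
  haBar : ∀ e ∈ la, (e.1.1, !e.1.2) ∉ la.map Prod.fst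
  /-- `x̄ᵢ` does not occur in `tⱼ` for `i ≤ j` -/
  haFv : ∀ i j, i ≤ j → j < la.length →
      Atom.var (la.getD i default).1.1 (!(la.getD i default).1.2) ∉ (la.getD j default).2.atoms
  /-- each member of `le` is a cut of `p` between a unit and a counit -/
  he : ∀ e ∈ le, (Tree.unit e.1, Tree.counit e.2) ∈ p.cuts ∨ (Tree.counit e.2, Tree.unit e.1) ∈ p.cuts
  heN : (le.map Prod.snd).Nodup
  /-- `jump(μᵢ) ∉ {⊥_{μⱼ}, 1_{λⱼ}}` for `i ≤ j` (in particular each eliminated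
      evanescent cut is reducible) -/
  heJ : ∀ i j, i ≤ j → j < le.length →
      p.jump ((le.getD i (0,0)).2) ≠ Tree.counit ((le.getD j (0,0)).2) ∧
      p.jump ((le.getD i (0,0)).2) ≠ Tree.unit ((le.getD j (0,0)).1)
  /-- the cuts of `q`: the remaining cuts plus the multiplicative residuals,
      under the substitution generated by the axiom cuts -/
  hcuts : q.cuts = ((p.cuts \ (melim F ∪ aelim la ∪ eelim le)) ∪ mres F).image
      (fun c => (Tree.substList la c.1, Tree.substList la c.2))
  /-- the conclusions of `q` -/
  hconcl : q.concl = p.concl.map (Tree.substList la)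
  /-- the jump function of `q`, with redirections -/
  hjump : ∀ m, Tree.counit m ∈ q.ST →
      (∃ c ∈ F, p.jump m = Tree.tens c.1 ∧ q.jump m = Tree.substList la c.1.headI) ∨
      (∃ c ∈ F, p.jump m = Tree.parr c.2 ∧ q.jump m = Tree.substList la c.2.headI) ∨
      (∃ i < la.length,
        (p.jump m = Tree.var (la.getD i default).1.1 (la.getD i default).1.2 ∨
         p.jump m = Tree.var (la.getD i default).1.1 (!(la.getD i default).1.2)) ∧
        q.jump m = Tree.substList (la.drop (i+1)) (la.getD i default).2) ∨
      (∃ i < le.length,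
        (p.jump m = Tree.counit ((le.getD i (0,0)).2) ∨
         p.jump m = Tree.unit ((le.getD i (0,0)).1)) ∧
        ∃ t, Rho p le i t ∧ q.jump m = Tree.substList la t) ∨
      ((∀ c ∈ F, p.jump m ≠ Tree.tens c.1 ∧ p.jump m ≠ Tree.parr c.2) ∧
       (∀ e ∈ la, p.jump m ≠ Tree.var e.1.1 e.1.2 ∧ p.jump m ≠ Tree.var e.1.1 (!e.1.2)) ∧
       (∀ e ∈ le, p.jump m ≠ Tree.counit e.2 ∧ p.jump m ≠ Tree.unit e.1) ∧
       q.jump m = Tree.substList la (p.jump m))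

/-- Parallel elimination of a family of multiplicative cuts (`p ⇒m q`). -/
def MultStep (p q : Net) : Prop := ∃ F, ParStepF p q F [] []

/-- Parallel elimination of a family of axiom cuts (`p ⇒a q`). -/
def AxStep (p q : Net) : Prop := ∃ la, ParStepF p q ∅ la []

/-- Parallel elimination of a family of evanescent cuts (`p ⇒e q`). -/
def EvStep (p q : Net) : Prop := ∃ le, ParStepF p q ∅ [] le

/-- A parallel cut elimination step (`p ⇒ q`), eliminating an arbitrary
    family of reducible cuts of the three kinds. -/
def ParStep (p q : Net) : Prop := ∃ F la le, ParStepF p q F la le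

/-- Elimination of a single reducible cut. -/
def Step1 (p q : Net) : Prop :=
  (∃ c, ParStepF p q {c} [] []) ∨ (∃ e, ParStepF p q ∅ [e] []) ∨ (∃ e, ParStepF p q ∅ [] [e])

/-- `k` parallel cut elimination steps. -/
def ParStepN : ℕ → Net → Net → Prop
  | 0, p, q => p = q
  | k+1, p, q => ∃ r, ParStep p r ∧ ParStepN k r q

/-! ### Evanescent cuts and the sets `Iⁿ(t)` -/

/-- `p.IsEvCut l m` : `⟨1_l | ⊥_m⟩` is a reducible evanescent cut of `p`. -/
def Net.IsEvCut (p : Net) (l m : ℕ) : Prop :=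
  ((Tree.unit l, Tree.counit m) ∈ p.cuts ∨ (Tree.counit m, Tree.unit l) ∈ p.cuts) ∧
  p.jump m ≠ Tree.unit l ∧ p.jump m ≠ Tree.counit m

/-- The sets `Iⁿ(t)` of counit labels reaching `t` through a chain of `n`
    evanescent cuts. -/
noncomputable def Net.Iset (p : Net) (t : Tree) : ℕ → Finset ℕ
  | 0 => p.counitLabels.filter fun m => p.jump m = t
  | n+1 => p.counitLabels.filter fun m' =>
      ∃ l m, p.IsEvCut l m ∧ m ∈ p.Iset t n ∧
        (p.jump m' = Tree.counit m ∨ p.jump m' = Tree.unit l)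

/-- The number of evanescent cuts of `p`. -/
noncomputable def Net.evCutCount (p : Net) : ℕ :=
  (p.cuts.filter fun c => ∃ l m,
    (c = (Tree.unit l, Tree.counit m) ∨ c = (Tree.counit m, Tree.unit l)) ∧
    p.jump m ≠ Tree.unit l ∧ p.jump m ≠ Tree.counit m).card

/-! ### The function φ -/

/-- `φ(0) = 0` and `φ(n) = n + (n+1)(φ(n-1)+2)` for `n > 0`. -/
def phi : ℕ → ℕ
  | 0 => 0
  | n + 1 => (n + 1) + (n + 2) * (phi n + 2)

/-! ### Residual edges, slipknots, bridges and bounces -/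

/-- The residual cut edges in `q` of an eliminated multiplicative cut. -/
noncomputable def resEdges (c : List Tree × List Tree) : Finset Edge :=
  ((c.1.zip c.2).map fun d => Edge.cutE d.1 d.2).toFinset

/-- Canonical form of a `c`-bridge: a path bound to `c` crossing its cut edge. -/
def IsBridgeCan (c : List Tree × List Tree) (b : List Edge) : Prop :=
  ∃ pre post : List Edge,
    (pre = [] ∨ ∃ t ∈ c.1, pre = [Edge.tensE (Tree.tens c.1) t]) ∧
    (post = [] ∨ post = [Edge.parrE (Tree.parr c.2)]) ∧
    (b = pre ++ Edge.cutE (Tree.tens c.1) (Tree.parr c.2) :: post ∨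
     b = pre ++ Edge.cutE (Tree.parr c.2) (Tree.tens c.1) :: post)

/-- A `c`-bridge, in either direction. -/
def IsBridge (c : List Tree × List Tree) (b : List Edge) : Prop :=
  IsBridgeCan c b ∨ IsBridgeCan c b.reverse

/-- A `c`-bounce: a path bound to `c`, not crossing its cut edge, and
    visiting its ⊗-tree. -/
def IsBounce (c : List Tree × List Tree) (b : List Edge) : Prop :=
  b = [] ∨ (∃ t ∈ c.1, b = [Edge.tensE (Tree.tens c.1) t]) ∨
  (∃ t ∈ c.1, ∃ t' ∈ c.1, t ≠ t' ∧
    b = [Edge.tensE (Tree.tens c.1) t, Edge.tensE (Tree.tens c.1) t'])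

/-- `Gen F es es'` : the edge sequence `es'` (in `p`) is generated by the
    straight edge sequence `es` (in `q`): preserved edges are kept, and each
    residual cut edge is replaced by a bridge of the corresponding
    eliminated cut. -/
inductive Gen (F : Finset (List Tree × List Tree)) : List Edge → List Edge → Prop
  | nil : Gen F [] []
  | pres {e l l'} : (∀ c ∈ F, e ∉ resEdges c) → Gen F l l' → Gen F (e :: l) (e :: l')
  | res {c d l l' b} : c ∈ F → d ∈ resEdges c → IsBridge c b → Gen F l l' →
      Gen F (d :: l) (b ++ l')

/-- A straight path: a path with no slipknot, i.e. crossing at most one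
    residual of each eliminated cut. -/
def Straight (F : Finset (List Tree × List Tree)) (l : List (Edge × Tree)) : Prop :=
  ¬ ∃ c ∈ F, ∃ l₁ l₂ l₃ : List (Edge × Tree), ∃ d v d' v',
      d ∈ resEdges c ∧ d' ∈ resEdges c ∧ l = l₁ ++ (d, v) :: l₂ ++ (d', v') :: l₃

/-- Independent paths: disjoint, and crossing residuals of no common
    eliminated cut. -/
def Indep (F : Finset (List Tree × List Tree)) (l₁ l₂ : List (Edge × Tree)) : Prop :=
  (∀ x ∈ l₁, ∀ y ∈ l₂, x.1 ≠ y.1) ∧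
  ¬ ∃ c ∈ F, (∃ x ∈ l₁, x.1 ∈ resEdges c) ∧ (∃ y ∈ l₂, y.1 ∈ resEdges c)

/-- `DecompWith F l cs χs ξs` : the decomposition `l = χ₁ξ₁⋯χₙξₙχₙ₊₁` of a
    path of `q` into pairwise independent straight paths `χᵢ` and slipknots
    `ξᵢ` on the pairwise distinct eliminated cuts `cs = c₁, …, cₙ`. -/
def DecompWith (F : Finset (List Tree × List Tree)) (l : List (Edge × Tree))
    (cs : List (List Tree × List Tree)) (χs ξs : List (List (Edge × Tree))) : Prop :=
  cs.Nodup ∧ (∀ c ∈ cs, c ∈ F) ∧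
  χs.length = cs.length + 1 ∧ ξs.length = cs.length ∧
  l = (List.zipWith (· ++ ·) χs (ξs ++ [[]])).flatten ∧
  (∀ x ∈ χs, Straight F x ∧ ∀ c ∈ cs, ∀ y ∈ x, y.1 ∉ resEdges c) ∧
  χs.Pairwise (Indep F) ∧
  List.Forall₂ (fun (ξ : List (Edge × Tree)) (c : List Tree × List Tree) =>
      ∃ t s t' s' mid, (t, s) ∈ c.1.zip c.2 ∧ (t', s') ∈ c.1.zip c.2 ∧ t ≠ t' ∧
        ξ = (Edge.cutE t s, s) :: mid ++ [(Edge.cutE t' s', t')]) ξs cs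

/-- `Decomp F l cs` : some decomposition of `l` along the cut sequence `cs`
    exists. -/
def Decomp (F : Finset (List Tree × List Tree)) (l : List (Edge × Tree))
    (cs : List (List Tree × List Tree)) : Prop :=
  ∃ χs ξs, DecompWith F l cs χs ξs

/-! ### α-equivalence -/

/-- A renaming of atoms: a map on variable names together with a possible
    flip of polarities (so as to commute with the involution), a map on unit
    labels and a map on counit labels. -/
structure Ren : Type where
  v : ℕ → ℕ
  vb : ℕ → Bool
  u : ℕ → ℕ
  c : ℕ → ℕ

/-- Applying a renaming to a tree. -/
def Tree.rename (r : Ren) : Tree → Tree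
  | Tree.var n b => Tree.var (r.v n) (xor b (r.vb n))
  | Tree.unit l => Tree.unit (r.u l)
  | Tree.counit l => Tree.counit (r.c l)
  | Tree.tens ts => Tree.tens (ts.attach.map (fun x => Tree.rename r x.1))
  | Tree.parr ts => Tree.parr (ts.attach.map (fun x => Tree.rename r x.1))
termination_by t => sizeOf t
decreasing_by all_goals (have h := List.sizeOf_lt_of_mem x.2; simp; omega)

/-- α-equivalence of nets: renaming of atoms (preserving the involution on
    variables) and reindexing of cuts. -/
def AlphaEq (p q : Net) : Prop :=
  ∃ r : Ren, Function.Bijective r.v ∧ Function.Bijective r.u ∧ Function.Bijective r.c ∧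
    q.cuts = p.cuts.image (fun c => (c.1.rename r, c.2.rename r)) ∧
    q.concl = p.concl.map (Tree.rename r) ∧
    (∀ m, Tree.counit m ∈ p.ST → q.jump (r.c m) = (p.jump m).rename r)

end MLLNets

namespace MLLNets

theorem mem_foldr_union {α : Type*} [DecidableEq α] (L : List (Finset α)) (x : α) :
    x ∈ L.foldr (· ∪ ·) ∅ ↔ ∃ s ∈ L, x ∈ s := by
  induction L with
  | nil => simp
  | cons a L ih => simp [ih]

theorem card_foldr_union_le {α : Type*} [DecidableEq α] (L : List (Finset α)) :
    (L.foldr (· ∪ ·) ∅).card ≤ (L.map Finset.card).sum := by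
  induction L with
  | nil => simp
  | cons a L ih =>
    simp only [List.foldr_cons, List.map_cons, List.sum_cons]
    exact (Finset.card_union_le _ _).trans (by omega)

attribute [local instance] Classical.propDecidable

namespace Tree

theorem mem_ST_tens {s : Tree} {ts : List Tree} :
    s ∈ (tens ts).ST ↔ s = tens ts ∨ ∃ t ∈ ts, s ∈ t.ST := by
  rw [ST, Finset.mem_insert, mem_foldr_union]
  simp

theorem mem_ST_parr {s : Tree} {ts : List Tree} :
    s ∈ (parr ts).ST ↔ s = parr ts ∨ ∃ t ∈ ts, s ∈ t.ST := by
  rw [ST, Finset.mem_insert, mem_foldr_union]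
  simp

theorem self_mem_ST (t : Tree) : t ∈ t.ST := by
  cases t <;> simp [ST]

theorem ST_trans {s t u : Tree} (hst : s ∈ t.ST) (htu : t ∈ u.ST) : s ∈ u.ST :=
  match u with
  | var n b => by simp only [ST, Finset.mem_singleton] at htu; simpa [htu] using hst
  | unit l => by simp only [ST, Finset.mem_singleton] at htu; simpa [htu] using hst
  | counit l => by simp only [ST, Finset.mem_singleton] at htu; simpa [htu] using hst
  | tens ts => by
    rcases mem_ST_tens.1 htu with rfl | ⟨v, hv, htv⟩
    · exact hst
    · exact mem_ST_tens.2 (.inr ⟨v, hv, ST_trans hst htv⟩)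
  | parr ts => by
    rcases mem_ST_parr.1 htu with rfl | ⟨v, hv, htv⟩
    · exact hst
    · exact mem_ST_parr.2 (.inr ⟨v, hv, ST_trans hst htv⟩)
termination_by sizeOf u
decreasing_by all_goals (have h := List.sizeOf_lt_of_mem hv; simp; omega)

theorem card_ST_le_size (t : Tree) : t.ST.card ≤ t.size :=
  match t with
  | var n b => by simp [ST, size]
  | unit l => by simp [ST, size]
  | counit l => by simp [ST, size]
  | tens ts => by
    rw [ST, size]
    refine (Finset.card_insert_le _ _).trans ?_
    rw [add_comm]
    refine Nat.add_le_add_left ((card_foldr_union_le _).trans ?_) 1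
    rw [List.map_map]
    exact List.sum_le_sum fun x _ => card_ST_le_size x.1
  | parr ts => by
    rw [ST, size]
    refine (Finset.card_insert_le _ _).trans ?_
    rw [add_comm]
    refine Nat.add_le_add_left ((card_foldr_union_le _).trans ?_) 1
    rw [List.map_map]
    exact List.sum_le_sum fun x _ => card_ST_le_size x.1
termination_by sizeOf t
decreasing_by all_goals (have h := List.sizeOf_lt_of_mem x.2; simp; omega)

end Tree

namespace Net

theorem mem_ST {p : Net} {t : Tree} :
    t ∈ p.ST ↔ (∃ c ∈ p.cuts, t ∈ c.1.ST ∨ t ∈ c.2.ST) ∨ ∃ u ∈ p.concl, t ∈ u.ST := by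
  rw [ST, Finset.mem_union, mem_foldr_union]
  simp

theorem ST_trans {p : Net} {s t : Tree} (hst : s ∈ t.ST) (ht : t ∈ p.ST) : s ∈ p.ST := by
  rw [mem_ST] at ht ⊢
  rcases ht with ⟨c, hc, h | h⟩ | ⟨u, hu, h⟩
  · exact .inl ⟨c, hc, .inl (Tree.ST_trans hst h)⟩
  · exact .inl ⟨c, hc, .inr (Tree.ST_trans hst h)⟩
  · exact .inr ⟨u, hu, Tree.ST_trans hst h⟩

theorem card_ST_le_size (p : Net) : p.ST.card ≤ p.size := by
  rw [ST, size]
  refine (Finset.card_union_le _ _).trans (Nat.add_le_add ?_ ?_)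
  · refine Finset.card_biUnion_le.trans (Finset.sum_le_sum fun c _ => ?_)
    exact (Finset.card_union_le _ _).trans
      (Nat.add_le_add (Tree.card_ST_le_size _) (Tree.card_ST_le_size _))
  · refine (card_foldr_union_le _).trans ?_
    rw [List.map_map]
    exact List.sum_le_sum fun x _ => Tree.card_ST_le_size x

theorem left_mem_ST {p : Net} {t s : Tree} (h : (t, s) ∈ p.cuts) : t ∈ p.ST :=
  mem_ST.2 (.inl ⟨_, h, .inl t.self_mem_ST⟩)

theorem right_mem_ST {p : Net} {t s : Tree} (h : (t, s) ∈ p.cuts) : s ∈ p.ST :=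
  mem_ST.2 (.inl ⟨_, h, .inr s.self_mem_ST⟩)

theorem mem_counitLabels {p : Net} {m : ℕ} : m ∈ p.counitLabels ↔ Tree.counit m ∈ p.ST := by
  simp only [counitLabels, Finset.mem_biUnion]
  constructor
  · rintro ⟨t, ht, h⟩
    cases t <;> simp_all
  · exact fun h => ⟨_, h, by simp⟩

theorem IsEvCut.unit_mem_ST {p : Net} {l m : ℕ} (h : p.IsEvCut l m) : Tree.unit l ∈ p.ST :=
  h.1.elim left_mem_ST right_mem_ST

theorem IsEvCut.counit_mem_ST {p : Net} {l m : ℕ} (h : p.IsEvCut l m) : Tree.counit m ∈ p.ST :=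
  h.1.elim right_mem_ST left_mem_ST

theorem IsMLL.exists_isSwitching {p : Net} (hp : p.IsMLL) : ∃ I, p.IsSwitching I := by
  refine ⟨fun t => match t with | Tree.parr ts => ts.headI | t => t, fun ts hts => ?_⟩
  have := hp.2.2.1 ts hts
  cases ts with
  | nil => exact absurd rfl this
  | cons a l => simp

theorem Adj.mem_ST {p : Net} (hp : p.IsMLL) {I : Tree → Tree} (hI : p.IsSwitching I)
    {e : Edge} {t u : Tree} (h : p.Adj I e t u) : t ∈ p.ST ∧ u ∈ p.ST := by
  induction h with
  | ax n h₁ h₂ => exact ⟨h₁, h₂⟩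
  | tens h₁ h₂ =>
    exact ⟨h₁, ST_trans (Tree.mem_ST_tens.2 (.inr ⟨_, h₂, Tree.self_mem_ST _⟩)) h₁⟩
  | parr h₁ =>
    exact ⟨h₁, ST_trans (Tree.mem_ST_parr.2 (.inr ⟨_, hI _ h₁, Tree.self_mem_ST _⟩)) h₁⟩
  | jump h₁ => exact ⟨h₁, hp.2.2.2.2 _ h₁⟩
  | cut h => exact ⟨left_mem_ST h, right_mem_ST h⟩
  | symm _ ih => exact ih.symm

theorem IsTrail.mem_ST {p : Net} (hp : p.IsMLL) {I : Tree → Tree} (hI : p.IsSwitching I)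
    {t : Tree} {l : List (Edge × Tree)} (h : p.IsTrail I t l) :
    ∀ x ∈ t :: l.map Prod.snd, x ∈ p.ST := by
  induction h with
  | nil t ht => simpa using ht
  | cons hadj _ _ ih =>
    rw [List.map_cons, List.forall_mem_cons]
    exact ⟨(hadj.mem_ST hp hI).1, ih⟩

theorem IsTrail.of_append {p : Net} (hp : p.IsMLL) {I : Tree → Tree} (hI : p.IsSwitching I)
    {l₁ l₂ : List (Edge × Tree)} {t : Tree} (h : p.IsTrail I t (l₁ ++ l₂)) :
    p.IsTrail I t l₁ := by
  induction l₁ generalizing t with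
  | nil => exact .nil t (h.mem_ST hp hI t (by simp))
  | cons a l₁ ih =>
    cases h with
    | cons hadj htl hne =>
      exact .cons hadj (ih htl) fun x hx => hne x (List.mem_append_left _ hx)

theorem IsTrail.nodup_edges {p : Net} {I : Tree → Tree} {t : Tree} {l : List (Edge × Tree)}
    (h : p.IsTrail I t l) : (l.map Prod.fst).Nodup := by
  induction h with
  | nil => simp
  | cons _ _ hne ih =>
    simp only [List.map_cons, List.nodup_cons]
    refine ⟨fun hmem => ?_, ih⟩
    obtain ⟨x, hx, hxe⟩ := List.mem_map.1 hmem
    exact hne x hx hxe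

theorem IsTrail.length_le_ln {p : Net} (hp : p.IsMLL) (hpa : p.IsAcyclic) {I : Tree → Tree}
    (hI : p.IsSwitching I) {t : Tree} {l : List (Edge × Tree)} (h : p.IsTrail I t l) :
    l.length ≤ p.ln := by
  refine le_csSup ⟨p.ST.card, ?_⟩ ⟨I, t, l, hI, h, rfl⟩
  rintro n ⟨J, u, l', hJ, h', rfl⟩
  have hcard := List.toFinset_card_of_nodup (hpa J hJ u l' h')
  have hle := Finset.card_le_card (s := (u :: l'.map Prod.snd).toFinset) (t := p.ST)
    fun x hx => h'.mem_ST hp hJ x (List.mem_toFinset.1 hx)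
  simp only [List.length_cons, List.length_map] at hcard
  omega

/-- `JumpPath p m l` : `l` is a sequence of steps starting from `⊥_m`, which follows jumps, each
possibly followed by the crossing of a cut from a unit to a counit. -/
inductive JumpPath (p : Net) : ℕ → List (Edge × Tree) → Prop
  | base {m} : Tree.counit m ∈ p.ST → JumpPath p m [(Edge.jumpE m, p.jump m)]
  | jump {m m' L} : Tree.counit m' ∈ p.ST → p.jump m' = Tree.counit m → JumpPath p m L →
      JumpPath p m' ((Edge.jumpE m', Tree.counit m) :: L)
  | cutL {k m m' L} : Tree.counit m' ∈ p.ST → p.jump m' = Tree.unit k →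
      (Tree.unit k, Tree.counit m) ∈ p.cuts → JumpPath p m L →
      JumpPath p m' ((Edge.jumpE m', Tree.unit k) ::
        (Edge.cutE (Tree.unit k) (Tree.counit m), Tree.counit m) :: L)
  | cutR {k m m' L} : Tree.counit m' ∈ p.ST → p.jump m' = Tree.unit k →
      (Tree.counit m, Tree.unit k) ∈ p.cuts → JumpPath p m L →
      JumpPath p m' ((Edge.jumpE m', Tree.unit k) ::
        (Edge.cutE (Tree.counit m) (Tree.unit k), Tree.counit m) :: L)

theorem JumpPath.exists_append {p : Net} {m : ℕ} {L : List (Edge × Tree)} (h : p.JumpPath m L)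
    {a : ℕ} {v : Tree} (hmem : (Edge.jumpE a, v) ∈ L) :
    ∃ l₁ l₂, L = l₁ ++ (Edge.jumpE a, v) :: l₂ ∧
      Tree.counit a ∈ Tree.counit m :: l₁.map Prod.snd := by
  induction h with
  | base hm =>
    simp only [List.mem_singleton, Prod.mk.injEq, Edge.jumpE.injEq] at hmem
    obtain ⟨rfl, rfl⟩ := hmem
    exact ⟨[], [], rfl, by simp⟩
  | @jump m m' L _ _ _ ih =>
    rcases List.mem_cons.1 hmem with heq | hmem
    · simp only [Prod.mk.injEq, Edge.jumpE.injEq] at heq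
      obtain ⟨rfl, rfl⟩ := heq
      exact ⟨[], L, rfl, by simp⟩
    · obtain ⟨l₁, l₂, rfl, h⟩ := ih hmem
      exact ⟨(Edge.jumpE m', Tree.counit m) :: l₁, l₂, rfl, List.mem_cons_of_mem _ h⟩
  | @cutL k m m' L _ _ _ _ ih =>
    rcases List.mem_cons.1 hmem with heq | hmem
    · simp only [Prod.mk.injEq, Edge.jumpE.injEq] at heq
      obtain ⟨rfl, rfl⟩ := heq
      exact ⟨[], _, rfl, by simp⟩
    · obtain ⟨l₁, l₂, rfl, h⟩ := ih (by simpa using hmem)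
      exact ⟨(Edge.jumpE m', Tree.unit k) ::
        (Edge.cutE (Tree.unit k) (Tree.counit m), Tree.counit m) :: l₁, l₂, rfl,
        List.mem_cons_of_mem _ (List.mem_cons_of_mem _ h)⟩
  | @cutR k m m' L _ _ _ _ ih =>
    rcases List.mem_cons.1 hmem with heq | hmem
    · simp only [Prod.mk.injEq, Edge.jumpE.injEq] at heq
      obtain ⟨rfl, rfl⟩ := heq
      exact ⟨[], _, rfl, by simp⟩
    · obtain ⟨l₁, l₂, rfl, h⟩ := ih (by simpa using hmem)
      exact ⟨(Edge.jumpE m', Tree.unit k) ::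
        (Edge.cutE (Tree.counit m) (Tree.unit k), Tree.counit m) :: l₁, l₂, rfl,
        List.mem_cons_of_mem _ (List.mem_cons_of_mem _ h)⟩

/-- The target of a cut crossed by a jump path is the counit of that cut. -/
theorem JumpPath.eq_of_cutE_mem {p : Net} {m : ℕ} {L : List (Edge × Tree)} (h : p.JumpPath m L)
    {k a : ℕ} {x : Edge × Tree} (hx : x ∈ L)
    (hmem : x.1 = Edge.cutE (Tree.unit k) (Tree.counit a) ∨
      x.1 = Edge.cutE (Tree.counit a) (Tree.unit k)) : x.2 = Tree.counit a := by
  induction h <;> simp only [List.mem_cons, List.not_mem_nil, or_false] at hx <;>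
    rcases hx with rfl | hx <;> try rcases hx with rfl | hx
  all_goals simp_all

/-- In an acyclic net, a jump leading to the origin of a trail whose vertices before a crossing of
that jump include its source cannot occur in the trail. -/
theorem IsTrail.cons_jump {p : Net} (hp : p.IsMLL) (hpa : p.IsAcyclic) {I : Tree → Tree}
    (hI : p.IsSwitching I) {m : ℕ} (hm : Tree.counit m ∈ p.ST) {L : List (Edge × Tree)}
    (hL : p.IsTrail I (p.jump m) L)
    (happ : ∀ v, (Edge.jumpE m, v) ∈ L → ∃ l₁ l₂, L = l₁ ++ (Edge.jumpE m, v) :: l₂ ∧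
      Tree.counit m ∈ p.jump m :: l₁.map Prod.snd) :
    p.IsTrail I (Tree.counit m) ((Edge.jumpE m, p.jump m) :: L) := by
  refine .cons (.jump hm) hL ?_
  rintro ⟨e, v⟩ hx rfl
  obtain ⟨l₁, l₂, rfl, hmem⟩ := happ v hx
  have hnd := hL.nodup_edges
  have htrail : p.IsTrail I (Tree.counit m) ((Edge.jumpE m, p.jump m) :: l₁) := by
    refine .cons (.jump hm) (hL.of_append hp hI) ?_
    rintro ⟨e, w⟩ hy rfl
    rw [List.map_append, List.nodup_append] at hnd
    exact hnd.2.2 _ (List.mem_map_of_mem hy) _ (by simp) rfl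
  have hnodup := hpa I hI _ _ htrail
  rw [List.nodup_cons] at hnodup
  exact hnodup.1 (by simpa using hmem)

theorem JumpPath.isTrail {p : Net} (hp : p.IsMLL) (hpa : p.IsAcyclic) {I : Tree → Tree}
    (hI : p.IsSwitching I) {m : ℕ} {L : List (Edge × Tree)} (h : p.JumpPath m L) :
    p.IsTrail I (Tree.counit m) L := by
  have cons_cut {k m m' : ℕ} {L : List (Edge × Tree)} {e : Edge}
      (hm' : Tree.counit m' ∈ p.ST) (hj : p.jump m' = Tree.unit k)
      (he : e = Edge.cutE (Tree.unit k) (Tree.counit m) ∨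
        e = Edge.cutE (Tree.counit m) (Tree.unit k))
      (hadj : p.Adj I e (Tree.unit k) (Tree.counit m)) (hL : p.JumpPath m L)
      (ih : p.IsTrail I (Tree.counit m) L) :
      p.IsTrail I (Tree.counit m')
        ((Edge.jumpE m', Tree.unit k) :: (e, Tree.counit m) :: L) := by
    have htl : p.IsTrail I (Tree.unit k) ((e, Tree.counit m) :: L) := by
      refine .cons hadj ih ?_
      rintro x hx rfl
      have hnodup := hpa I hI _ _ ih
      rw [List.nodup_cons] at hnodup
      exact hnodup.1 (hL.eq_of_cutE_mem hx he ▸ List.mem_map_of_mem hx)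
    rw [← hj] at htl ⊢
    refine htl.cons_jump hp hpa hI hm' fun v hv => ?_
    have hv' : (Edge.jumpE m', v) ∈ L := by
      rcases List.mem_cons.1 hv with hv | hv
      · rcases he with rfl | rfl <;> simp at hv
      · exact hv
    obtain ⟨l₁, l₂, rfl, hmem⟩ := hL.exists_append hv'
    exact ⟨(e, Tree.counit m) :: l₁, l₂, rfl, List.mem_cons_of_mem _ hmem⟩
  induction h with
  | base hm =>
    exact .cons (.jump hm) (.nil _ (hp.2.2.2.2 _ hm)) (by simp)
  | jump hm' hj hL ih =>
    rw [← hj] at ih ⊢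
    exact ih.cons_jump hp hpa hI hm' fun v hv => hj ▸ hL.exists_append hv
  | cutL hm' hj hc hL ih => exact cons_cut hm' hj (.inl rfl) (.cut hc) hL ih
  | cutR hm' hj hc hL ih => exact cons_cut hm' hj (.inr rfl) (.symm (.cut hc)) hL ih

theorem exists_jumpPath_of_mem_Iset {p : Net} {t : Tree} {n m : ℕ} (h : m ∈ p.Iset t n) :
    ∃ L, p.JumpPath m L ∧ n + 1 ≤ L.length := by
  induction n generalizing m with
  | zero =>
    rw [Iset, Finset.mem_filter, mem_counitLabels] at h
    exact ⟨_, .base h.1, le_rfl⟩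
  | succ n ih =>
    rw [Iset, Finset.mem_filter, mem_counitLabels] at h
    obtain ⟨hm, k, a, hev, ha, hj⟩ := h
    obtain ⟨L, hL, hlen⟩ := ih ha
    rcases hj with hj | hj
    · exact ⟨_, .jump hm hj hL, by simpa using hlen⟩
    · rcases hev.1 with hc | hc
      · exact ⟨_, .cutL hm hj hc hL, by simp only [List.length_cons]; omega⟩
      · exact ⟨_, .cutR hm hj hc hL, by simp only [List.length_cons]; omega⟩

theorem lt_ln_of_mem_Iset {p : Net} (hp : p.IsMLL) (hpa : p.IsAcyclic) {t : Tree} {n m : ℕ}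
    (h : m ∈ p.Iset t n) : n < p.ln := by
  obtain ⟨L, hL, hlen⟩ := exists_jumpPath_of_mem_Iset h
  obtain ⟨I, hI⟩ := hp.exists_isSwitching
  exact hlen.trans ((hL.isTrail hp hpa hI).length_le_ln hp hpa hI)

theorem card_filter_jump_le_jd {p : Net} {t : Tree} (ht : t ∈ p.ST) :
    (p.counitLabels.filter fun m => p.jump m = t).card ≤ p.jd :=
  Finset.le_sup (f := fun t => (p.counitLabels.filter fun m => p.jump m = t).card) ht

/-- Cuts of a well-formed net sharing an atom are equal. -/
theorem IsMLL.cut_eq_of_mem_atoms {p : Net} (hp : p.IsMLL) {c d : Tree × Tree} (hc : c ∈ p.cuts)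
    (hd : d ∈ p.cuts) {a : Atom} (hac : a ∈ c.1.atoms + c.2.atoms)
    (had : a ∈ d.1.atoms + d.2.atoms) : c = d := by
  by_contra hne
  obtain ⟨s, hs⟩ := Multiset.exists_cons_of_mem (show c ∈ p.cuts.val from hc)
  have hds : d ∈ s := by
    have hd' : d ∈ p.cuts.val := hd
    rw [hs, Multiset.mem_cons] at hd'
    exact hd'.resolve_left (Ne.symm hne)
  obtain ⟨s', rfl⟩ := Multiset.exists_cons_of_mem hds
  have hnd := hp.1
  rw [atoms, hs, Multiset.map_cons, Multiset.map_cons, Multiset.sum_cons, Multiset.sum_cons] at hnd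
  rw [Multiset.nodup_add] at hnd
  have hdisj := (Multiset.nodup_add.1 hnd.1).2.2
  exact Multiset.disjoint_left.1 hdisj hac (Multiset.mem_add.2 (.inl had))

theorem IsMLL.evCut_unique {p : Net} (hp : p.IsMLL) {k k' m : ℕ} (h : p.IsEvCut k m)
    (h' : p.IsEvCut k' m) : k = k' := by
  have key {c d : Tree × Tree} (hc : c ∈ p.cuts) (hd : d ∈ p.cuts)
      (hac : Atom.counit m ∈ c.1.atoms + c.2.atoms)
      (had : Atom.counit m ∈ d.1.atoms + d.2.atoms) : c = d :=
    hp.cut_eq_of_mem_atoms hc hd hac had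
  rcases h.1 with hc | hc <;> rcases h'.1 with hd | hd <;>
    simpa using key hc hd (by simp [Tree.atoms]) (by simp [Tree.atoms])

theorem card_Iset_le {p : Net} (hp : p.IsMLL) {t : Tree} (ht : t ∈ p.ST) (n : ℕ) :
    (p.Iset t n).card ≤ p.jd * (2 * p.jd) ^ n := by
  induction n with
  | zero => simpa [Iset] using card_filter_jump_le_jd ht
  | succ n ih =>
    have hfib (m : ℕ) : (p.counitLabels.filter fun m' =>
        ∃ l, p.IsEvCut l m ∧ (p.jump m' = Tree.counit m ∨ p.jump m' = Tree.unit l)).card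
        ≤ 2 * p.jd := by
      by_cases hm : ∃ l, p.IsEvCut l m
      · obtain ⟨k, hk⟩ := hm
        have hsub : (p.counitLabels.filter fun m' =>
            ∃ l, p.IsEvCut l m ∧ (p.jump m' = Tree.counit m ∨ p.jump m' = Tree.unit l)) ⊆
            (p.counitLabels.filter fun m' => p.jump m' = Tree.counit m) ∪
            (p.counitLabels.filter fun m' => p.jump m' = Tree.unit k) := by
          intro a ha
          simp only [Finset.mem_filter, Finset.mem_union] at ha ⊢
          obtain ⟨ha, l, hl, h⟩ := ha
          rw [hp.evCut_unique hl hk] at h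
          tauto
        have h₁ := card_filter_jump_le_jd hk.counit_mem_ST
        have h₂ := card_filter_jump_le_jd hk.unit_mem_ST
        have h₃ := (Finset.card_le_card hsub).trans (Finset.card_union_le _ _)
        omega
      · rw [Finset.filter_false_of_mem fun a _ ⟨l, hl, _⟩ => hm ⟨l, hl⟩]
        simp
    have hsub : p.Iset t (n + 1) ⊆ (p.Iset t n).biUnion fun m => p.counitLabels.filter fun m' =>
        ∃ l, p.IsEvCut l m ∧ (p.jump m' = Tree.counit m ∨ p.jump m' = Tree.unit l) := by
      intro a ha
      rw [Iset, Finset.mem_filter] at ha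
      obtain ⟨ha, l, m, hev, hm, h⟩ := ha
      exact Finset.mem_biUnion.2 ⟨m, hm, Finset.mem_filter.2 ⟨ha, l, hev, h⟩⟩
    calc (p.Iset t (n + 1)).card ≤ (p.Iset t n).card * (2 * p.jd) :=
          (Finset.card_le_card hsub).trans (Finset.card_biUnion_le_card_mul _ _ _ fun m _ => hfib m)
      _ ≤ p.jd * (2 * p.jd) ^ n * (2 * p.jd) := Nat.mul_le_mul_right _ ih
      _ = p.jd * (2 * p.jd) ^ (n + 1) := by ring

theorem sum_mul_pow_le (d N : ℕ) :
    ∑ n ∈ Finset.range N, d * (2 * d) ^ n ≤ (2 * d) ^ (N + 1) := by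
  rcases Nat.eq_zero_or_pos d with rfl | hd
  · simp
  · rw [← Finset.mul_sum, pow_succ']
    exact Nat.mul_le_mul (by omega) (Nat.geomSum_lt (by omega) (by simp)).le

theorem card_biUnion_Iset_le {p : Net} (hp : p.IsMLL) {t : Tree} (ht : t ∈ p.ST) :
    ((Finset.range p.ln).biUnion (p.Iset t)).card ≤ (2 * p.jd) ^ (p.ln + 1) :=
  Finset.card_biUnion_le.trans <|
    (Finset.sum_le_sum fun n _ => card_Iset_le hp ht n).trans (sum_mul_pow_le _ _)

theorem evCutCount_le_card_counitLabels {p : Net} (hp : p.IsMLL) :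
    p.evCutCount ≤ p.counitLabels.card := by
  have hex (c : Tree × Tree) : ∃ m, c ∈ (p.cuts.filter fun c => ∃ l m,
      (c = (Tree.unit l, Tree.counit m) ∨ c = (Tree.counit m, Tree.unit l)) ∧
      p.jump m ≠ Tree.unit l ∧ p.jump m ≠ Tree.counit m) →
      c ∈ p.cuts ∧ m ∈ p.counitLabels ∧ Atom.counit m ∈ c.1.atoms + c.2.atoms := by
    by_cases hc : c ∈ p.cuts.filter fun c => ∃ l m,
      (c = (Tree.unit l, Tree.counit m) ∨ c = (Tree.counit m, Tree.unit l)) ∧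
      p.jump m ≠ Tree.unit l ∧ p.jump m ≠ Tree.counit m
    · obtain ⟨hc, l, m, rfl | rfl, -⟩ := Finset.mem_filter.1 hc
      · exact ⟨m, fun _ => ⟨hc, mem_counitLabels.2 (right_mem_ST hc), by simp [Tree.atoms]⟩⟩
      · exact ⟨m, fun _ => ⟨hc, mem_counitLabels.2 (left_mem_ST hc), by simp [Tree.atoms]⟩⟩
    · exact ⟨0, fun h => absurd h hc⟩
  choose f hf using hex
  refine Finset.card_le_card_of_injOn f (fun c hc => (hf c hc).2.1) fun c hc d hd hcd => ?_
  exact hp.cut_eq_of_mem_atoms (hf c hc).1 (hf d hd).1 (hf c hc).2.2 (hcd ▸ (hf d hd).2.2)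

end Net

theorem mem_eelim {le : List (ℕ × ℕ)} {c : Tree × Tree} (h : c ∈ eelim le) :
    ∃ e ∈ le, c = (Tree.unit e.1, Tree.counit e.2) ∨ c = (Tree.counit e.2, Tree.unit e.1) := by
  induction le with
  | nil => simp [eelim] at h
  | cons a le ih =>
    simp only [eelim, List.foldr_cons, Finset.mem_insert] at h
    rcases h with h | h | h
    · exact ⟨a, by simp, .inl h⟩
    · exact ⟨a, by simp, .inr h⟩
    · obtain ⟨e, he, h⟩ := ih h
      exact ⟨e, List.mem_cons_of_mem _ he, h⟩

namespace ParStepF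

variable {p q : Net} {le : List (ℕ × ℕ)}

theorem cuts_eq (h : ParStepF p q ∅ [] le) : q.cuts = p.cuts \ eelim le := by
  rw [h.hcuts]
  simp [melim, mres, aelim, Tree.substList]

theorem concl_eq (h : ParStepF p q ∅ [] le) : q.concl = p.concl := by
  rw [h.hconcl]
  exact List.map_id _

theorem ST_subset (h : ParStepF p q ∅ [] le) : q.ST ⊆ p.ST := by
  intro t ht
  rw [Net.mem_ST, h.cuts_eq, h.concl_eq] at ht
  rw [Net.mem_ST]
  exact ht.imp_left fun ⟨c, hc, h⟩ => ⟨c, (Finset.mem_sdiff.1 hc).1, h⟩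

theorem mem_ST_or_eliminated (h : ParStepF p q ∅ [] le) {t : Tree} (ht : t ∈ p.ST) :
    t ∈ q.ST ∨ ∃ i < le.length, t = Tree.counit (le.getD i (0, 0)).2 ∨
      t = Tree.unit (le.getD i (0, 0)).1 := by
  rw [Net.mem_ST] at ht
  rw [Net.mem_ST, h.cuts_eq, h.concl_eq]
  rcases ht with ⟨c, hc, hct⟩ | ht
  · by_cases hce : c ∈ eelim le
    · obtain ⟨e, he, hce⟩ := mem_eelim hce
      obtain ⟨i, hi, rfl⟩ := List.getElem_of_mem he
      refine .inr ⟨i, hi, ?_⟩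
      rw [List.getD_eq_getElem _ _ hi]
      rcases hce with rfl | rfl <;> simp only [Tree.ST, Finset.mem_singleton] at hct <;> tauto
    · exact .inl (.inl ⟨c, Finset.mem_sdiff.2 ⟨hc, hce⟩, hct⟩)
  · exact .inl (.inr ht)

theorem isEvCut (h : ParStepF p q ∅ [] le) {i : ℕ} (hi : i < le.length) :
    p.IsEvCut (le.getD i (0, 0)).1 (le.getD i (0, 0)).2 := by
  refine ⟨?_, (h.heJ i i le_rfl hi).2, (h.heJ i i le_rfl hi).1⟩
  rw [List.getD_eq_getElem _ _ hi]
  exact h.he _ (List.getElem_mem hi)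

theorem exists_mem_Iset_eliminated (hp : p.IsMLL) (h : ParStepF p q ∅ [] le) (i : ℕ)
    (hi : i < le.length) : ∃ s ∈ q.ST, ∃ n, (le.getD i (0, 0)).2 ∈ p.Iset s n := by
  induction i using Nat.strong_induction_on with
  | _ i ih =>
    have hm := (h.isEvCut hi).counit_mem_ST
    rcases h.mem_ST_or_eliminated (hp.2.2.2.2 _ hm) with hq | ⟨j, hj, hjump⟩
    · exact ⟨_, hq, 0, Finset.mem_filter.2 ⟨Net.mem_counitLabels.2 hm, rfl⟩⟩
    · have hji : j < i := by
        by_contra hij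
        have := h.heJ i j (not_lt.1 hij) hj
        tauto
      obtain ⟨s, hs, n, hn⟩ := ih j hji hj
      exact ⟨s, hs, n + 1, Finset.mem_filter.2
        ⟨Net.mem_counitLabels.2 hm, _, _, h.isEvCut hj, hn, hjump⟩⟩

theorem exists_mem_Iset (hp : p.IsMLL) (h : ParStepF p q ∅ [] le) {m : ℕ}
    (hm : m ∈ p.counitLabels) : ∃ s ∈ q.ST, ∃ n, m ∈ p.Iset s n := by
  rcases h.mem_ST_or_eliminated (hp.2.2.2.2 _ (Net.mem_counitLabels.1 hm)) with
    hq | ⟨j, hj, hjump⟩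
  · exact ⟨_, hq, 0, Finset.mem_filter.2 ⟨hm, rfl⟩⟩
  · obtain ⟨s, hs, n, hn⟩ := h.exists_mem_Iset_eliminated hp j hj
    exact ⟨s, hs, n + 1, Finset.mem_filter.2 ⟨hm, _, _, h.isEvCut hj, hn, hjump⟩⟩

end ParStepF

end MLLNets

namespace MLLNets

/-- Let `p` and `q` be acyclic MLL proof nets with `p ⇒e q`
    (parallel elimination of a family of evanescent cuts). Then:
    (1) for every subtree `t` of `p`, the cardinality of `⋃ₙ Iⁿ(t)` is at
    most `(2·jd(p))^(ln(p)+1)`; and (2) the number of evanescent cuts in `p`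
    is at most `size(q)·(2·jd(p))^(ln(p)+1)`. -/
theorem ev_Iset_bound (p q : Net)
    (hp : p.IsMLL) (hq : q.IsMLL) (hpa : p.IsAcyclic) (hqa : q.IsAcyclic)
    (h : EvStep p q) :
    (∀ t ∈ p.ST, (⋃ n : ℕ, (p.Iset t n : Set ℕ)).ncard ≤ (2 * p.jd) ^ (p.ln + 1)) ∧
    p.evCutCount ≤ q.size * (2 * p.jd) ^ (p.ln + 1) := by
  have mem_biUnion {t : Tree} {n m : ℕ} (hm : m ∈ p.Iset t n) :
      m ∈ (Finset.range p.ln).biUnion (p.Iset t) :=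
    Finset.mem_biUnion.2 ⟨n, Finset.mem_range.2 (Net.lt_ln_of_mem_Iset hp hpa hm), hm⟩
  refine ⟨fun t ht => ?_, ?_⟩
  · refine le_trans ?_ (Net.card_biUnion_Iset_le hp ht)
    rw [← Set.ncard_coe_finset]
    refine Set.ncard_le_ncard (Set.iUnion_subset fun n m hm => ?_) (Finset.finite_toSet _)
    exact mem_biUnion hm
  · obtain ⟨le, h⟩ := h
    have hsub : p.counitLabels ⊆
        q.ST.biUnion fun s => (Finset.range p.ln).biUnion (p.Iset s) := by
      intro m hm
      obtain ⟨s, hs, n, hn⟩ := h.exists_mem_Iset hp hm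
      exact Finset.mem_biUnion.2 ⟨s, hs, mem_biUnion hn⟩
    calc p.evCutCount ≤ p.counitLabels.card := Net.evCutCount_le_card_counitLabels hp
      _ ≤ q.ST.card * (2 * p.jd) ^ (p.ln + 1) :=
          (Finset.card_le_card hsub).trans (Finset.card_biUnion_le_card_mul _ _ _ fun s hs =>
            Net.card_biUnion_Iset_le hp (h.ST_subset hs))
      _ ≤ q.size * (2 * p.jd) ^ (p.ln + 1) := Nat.mul_le_mul_right _ q.card_ST_le_size

end MLLNets
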